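/- Let n ≥ 1, let p⃗=(p_1,…,p_n) satisfy 1<p_i<∞ for all i, and let 0<s<n/p_i for every i=1,…,n. Then there exists a constant C>0 such that for all Schwartz functions f on ℝⁿ, ‖ f(x)/|x|^s ‖_{L^{p⃗}(ℝⁿ)} ≤ C ‖ Λ^s f ‖_{L^{p⃗}(ℝⁿ)}, where the mixed (anisotropic) Lebesgue norm is taken first in x_1 with exponent p_1, then in x_2 with exponent p_2, etc. -/

import Mathlib

open MeasureTheory ENNReal Real Set

noncomputable section

/-- The decreasing rearrangement of an `ℝ≥0∞`-valued function. -/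
def rearr {α : Type*} [MeasurableSpace α] (μ : Measure α) (f : α → ℝ≥0∞) (t : ℝ) : ℝ≥0∞ :=
  sInf {s : ℝ≥0∞ | μ {x | s < f x} ≤ ENNReal.ofReal t}

/-- The Lorentz `L^{p,q}` quasi-norm, `‖f‖_{p,q} = ‖ t^{1/p} f*(t) ‖_{L^q((0,∞),dt/t)}`,
with `q = ∞` giving the weak-`L^p` quasi-norm. -/
def lorentzNorm {α : Type*} [MeasurableSpace α] (μ : Measure α) (p q : ℝ≥0∞)
    (f : α → ℝ≥0∞) : ℝ≥0∞ :=
  if q = ∞ then ⨆ t ∈ Set.Ioi (0 : ℝ), ENNReal.ofReal t ^ p⁻¹.toReal * rearr μ f t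
  else (∫⁻ t in Set.Ioi (0 : ℝ),
      (ENNReal.ofReal t ^ p⁻¹.toReal * rearr μ f t) ^ q.toReal / ENNReal.ofReal t) ^ q⁻¹.toReal

/-- Mixed (anisotropic) Lorentz quasi-norm on `ℝⁿ`: the Lorentz quasi-norm is taken
iteratively in each coordinate, with the coordinate `x 0` innermost. -/
def mixedLorentz : (n : ℕ) → (Fin n → ℝ≥0∞) → (Fin n → ℝ≥0∞) →
    ((Fin n → ℝ) → ℝ≥0∞) → ℝ≥0∞
  | 0, _, _, f => f (fun i => i.elim0)
  | n + 1, p, q, f => mixedLorentz n (fun i => p i.succ) (fun i => q i.succ)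
      (fun y => lorentzNorm (volume : Measure ℝ) (p 0) (q 0) (fun x => f (Fin.cons x y)))

/-- Mixed (anisotropic) Lebesgue norm on `ℝⁿ`, coordinate `x 0` innermost. -/
def mixedLp : (n : ℕ) → (Fin n → ℝ) → ((Fin n → ℝ) → ℝ≥0∞) → ℝ≥0∞
  | 0, _, f => f (fun i => i.elim0)
  | n + 1, p, f => mixedLp n (fun i => p i.succ)
      (fun y => (∫⁻ x : ℝ, (f (Fin.cons x y)) ^ (p 0)) ^ (1 / p 0))

/-- The Fourier transform on `ℝⁿ`, normalized as `(2π)^{-n/2} ∫ f(x) e^{-i ξ·x} dx`. -/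
def ft (n : ℕ) (f : (Fin n → ℝ) → ℂ) (ξ : Fin n → ℝ) : ℂ :=
  (((2 * π) ^ (-(n : ℝ) / 2) : ℝ) : ℂ) *
    ∫ x : Fin n → ℝ, Complex.exp (-(Complex.I * ((∑ i, ξ i * x i : ℝ) : ℂ))) * f x

/-- `Λ^s` acting only in the coordinates of `S`: the Fourier multiplier with symbol
`(∑_{i ∈ S} |ξ i|²)^{s/2}`. -/
def fracLapOn (n : ℕ) (S : Finset (Fin n)) (s : ℝ) (f : (Fin n → ℝ) → ℂ)
    (x : Fin n → ℝ) : ℂ :=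
  ft n (fun ξ => ((((∑ i ∈ S, ξ i ^ 2) ^ (s / 2) : ℝ)) : ℂ) * ft n f ξ) (-x)

/-- The fractional Laplacian `Λ^s = (−Δ)^{s/2}`. -/
def fracLap (n : ℕ) (s : ℝ) (f : (Fin n → ℝ) → ℂ) : (Fin n → ℝ) → ℂ :=
  fracLapOn n Finset.univ s f



lemma hs_minkowski {T α : Type*} [MeasurableSpace T] [MeasurableSpace α] (μ : Measure T)
    [SFinite μ] (ν : Measure α) [SigmaFinite ν] (F : T → α → ℝ≥0∞)
    (hF : Measurable (Function.uncurry F)) {p : ℝ} (hp : 1 < p) :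
    (∫⁻ x, (∫⁻ t, F t x ∂μ) ^ p ∂ν) ^ (1 / p) ≤ ∫⁻ t, (∫⁻ x, F t x ^ p ∂ν) ^ (1 / p) ∂μ := by
  have hp0 : 0 < p := by linarith
  set M := ∫⁻ t, (∫⁻ x, F t x ^ p ∂ν) ^ (1 / p) ∂μ with hM
  set G : α → ℝ≥0∞ := fun x => ∫⁻ t, F t x ∂μ with hG
  have hGm : Measurable G := Measurable.lintegral_prod_left' hF
  set q := Real.conjExponent p with hq
  have hpq : p.HolderConjugate q := Real.HolderConjugate.conjExponent hp
  have claim : ∀ h : α → ℝ≥0∞, Measurable h → (∀ x, h x ≤ G x) → (∀ x, h x ≠ ∞) →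
      ∫⁻ x, h x ^ p ∂ν ≠ ∞ → ∫⁻ x, h x ^ p ∂ν ≤ M ^ p := by
    intro h hh hle htop hfin
    set I := ∫⁻ x, h x ^ p ∂ν with hI
    have h1 : I ≤ M * I ^ (1 / q) := by
      calc I ≤ ∫⁻ x, ∫⁻ t, F t x * h x ^ (p - 1) ∂μ ∂ν := by
            apply lintegral_mono
            intro x
            have hFx : Measurable (fun t => F t x) := hF.comp (measurable_id.prodMk measurable_const)
            change h x ^ p ≤ ∫⁻ t, F t x * h x ^ (p - 1) ∂μ
            rw [lintegral_mul_const _ hFx]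
            calc h x ^ p = h x ^ (1 + (p - 1)) := by ring_nf
              _ = h x * h x ^ (p - 1) := by
                rw [ENNReal.rpow_add_of_nonneg _ _ zero_le_one (by linarith), ENNReal.rpow_one]
              _ ≤ _ := by gcongr; exact hle x
        _ = ∫⁻ t, ∫⁻ x, F t x * h x ^ (p - 1) ∂ν ∂μ := by
            rw [lintegral_lintegral_swap]
            apply Measurable.aemeasurable
            exact (hF.comp measurable_swap).mul ((hh.comp measurable_fst).pow_const _)
        _ ≤ ∫⁻ t, (∫⁻ x, F t x ^ p ∂ν) ^ (1 / p) * I ^ (1 / q) ∂μ := by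
            apply lintegral_mono
            intro t
            have := ENNReal.lintegral_mul_le_Lp_mul_Lq ν hpq (f := F t) (g := fun x => h x ^ (p - 1))
              (hF.comp (measurable_const.prodMk measurable_id)).aemeasurable
              (hh.pow_const _).aemeasurable
            refine this.trans (le_of_eq ?_)
            congr 2
            apply lintegral_congr
            intro x
            rw [← ENNReal.rpow_mul, hpq.sub_one_mul_conj]
        _ = M * I ^ (1 / q) := by
            rw [lintegral_mul_const]
            exact Measurable.pow_const (Measurable.lintegral_prod_right'
              (f := fun z : T × α => F z.1 z.2 ^ p) (hF.pow_const _)) _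
    by_cases hI0 : I = 0
    · rw [hI0]; exact zero_le
    have h2 : I ^ (1 / p) ≤ M := by
      have e : I = I ^ (1 / p) * I ^ (1 / q) := by
        rw [← ENNReal.rpow_add _ _ hI0 hfin]
        have := hpq.inv_add_inv_eq_one
        rw [one_div, one_div, this, ENNReal.rpow_one]
      have h1' : I ^ (1 / p) * I ^ (1 / q) ≤ M * I ^ (1 / q) := by rwa [← e]
      refine (ENNReal.mul_le_mul_iff_left ?_ ?_).1 h1'
      · simp [hI0, hfin]
      · exact ENNReal.rpow_ne_top_of_nonneg (by have := hpq.symm.pos; positivity) hfin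
    calc I = (I ^ (1 / p)) ^ p := by
          rw [← ENNReal.rpow_mul, one_div_mul_cancel hp0.ne', ENNReal.rpow_one]
      _ ≤ M ^ p := by gcongr
  have main : ∫⁻ x, G x ^ p ∂ν ≤ M ^ p := by
    refine le_of_forall_lt fun L hL => ?_
    rw [lintegral_eq_nnreal] at hL
    obtain ⟨φ, hφ⟩ := lt_iSup_iff.1 hL
    obtain ⟨hφ1, hφ2⟩ := lt_iSup_iff.1 hφ
    rw [← SimpleFunc.lintegral_eq_lintegral] at hφ2
    simp only [SimpleFunc.map_apply] at hφ2
    obtain ⟨g, hg, hfin, hlt⟩ := SimpleFunc.exists_lt_lintegral_simpleFunc_of_lt_lintegral hφ2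
    refine hlt.trans_le ?_
    have e : ∀ x, (((g x : ℝ≥0∞)) ^ (1 / p)) ^ p = g x := fun x => by
      rw [← ENNReal.rpow_mul, one_div_mul_cancel hp0.ne', ENNReal.rpow_one]
    have := claim (fun x => (g x : ℝ≥0∞) ^ (1 / p))
      (g.measurable.coe_nnreal_ennreal.pow_const _) ?_ ?_ ?_
    · simpa only [e] using this
    · intro x
      calc (g x : ℝ≥0∞) ^ (1 / p) ≤ (G x ^ p) ^ (1 / p) := by gcongr; exact (ENNReal.coe_le_coe.2 (hg x)).trans (hφ1 x)
        _ = G x := by rw [← ENNReal.rpow_mul, mul_one_div_cancel hp0.ne', ENNReal.rpow_one]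
    · intro x
      exact ENNReal.rpow_ne_top_of_nonneg (by positivity) ENNReal.coe_ne_top
    · simpa only [e] using hfin.ne
  calc _ ≤ (M ^ p) ^ (1 / p) := by gcongr
    _ = M := by rw [← ENNReal.rpow_mul, mul_one_div_cancel hp0.ne', ENNReal.rpow_one]

lemma hs_measurable_cons (n : ℕ) :
    Measurable (fun z : ℝ × (Fin n → ℝ) => (Fin.cons z.1 z.2 : Fin (n + 1) → ℝ)) := by
  refine measurable_pi_lambda _ fun i => ?_
  induction i using Fin.cases with
  | zero => simp only [Fin.cons_zero]; fun_prop
  | succ j => simp only [Fin.cons_succ]; fun_prop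

lemma mixedLp_measurable : ∀ (n : ℕ) (p : Fin n → ℝ) {T : Type} [MeasurableSpace T]
    (F : T → (Fin n → ℝ) → ℝ≥0∞), Measurable (Function.uncurry F) →
    Measurable (fun t => mixedLp n p (F t))
  | 0, p, T, _, F, hF => by
      simp only [mixedLp]
      exact hF.comp (measurable_id.prodMk measurable_const)
  | n + 1, p, T, _, F, hF => by
      simp only [mixedLp]
      refine mixedLp_measurable n _ (fun t y => (∫⁻ x : ℝ, (F t (Fin.cons x y)) ^ (p 0)) ^ (1 / p 0)) ?_
      refine Measurable.pow_const ?_ _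
      refine Measurable.lintegral_prod_right'
        (f := fun z : (T × (Fin n → ℝ)) × ℝ => F z.1.1 (Fin.cons z.2 z.1.2) ^ p 0) ?_
      refine Measurable.pow_const ?_ _
      refine hF.comp (measurable_fst.fst.prodMk ?_)
      exact (hs_measurable_cons n).comp (measurable_snd.prodMk measurable_fst.snd)

lemma mixedLp_mono_off : ∀ (n : ℕ) (p : Fin n → ℝ), (∀ i, 0 < p i) →
    ∀ (f g : (Fin n → ℝ) → ℝ≥0∞), (∀ x, (∀ i, x i ≠ 0) → f x ≤ g x) →
    mixedLp n p f ≤ mixedLp n p g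
  | 0, p, _, f, g, h => by
      simp only [mixedLp]
      exact h _ (fun i => i.elim0)
  | n + 1, p, hp, f, g, h => by
      simp only [mixedLp]
      refine mixedLp_mono_off n _ (fun i => hp i.succ) _ _ fun y hy => ?_
      have hp0 := hp 0
      gcongr ?_ ^ _
      apply lintegral_mono_ae
      have : ∀ᵐ x : ℝ, x ≠ 0 := by simp [ae_iff]
      filter_upwards [this] with x hx
      gcongr
      apply h
      intro i
      refine Fin.cases ?_ (fun j => ?_) i
      · simpa using hx
      · simpa using hy j

lemma mixedLp_const_mul : ∀ (n : ℕ) (p : Fin n → ℝ), (∀ i, 0 < p i) →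
    ∀ (f : (Fin n → ℝ) → ℝ≥0∞) (c : ℝ≥0∞), c ≠ ∞ →
    mixedLp n p (fun x => c * f x) = c * mixedLp n p f
  | 0, p, _, f, c, hc => by simp only [mixedLp]
  | n + 1, p, hp, f, c, hc => by
      simp only [mixedLp]
      rw [← mixedLp_const_mul n _ (fun i => hp i.succ) _ c hc]
      congr 1
      ext y
      have hp0 := hp 0
      simp_rw [ENNReal.mul_rpow_of_nonneg _ _ hp0.le]
      rw [lintegral_const_mul' _ _ (ENNReal.rpow_ne_top_of_nonneg hp0.le hc),
        ENNReal.mul_rpow_of_nonneg _ _ (by positivity), ← ENNReal.rpow_mul,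
        mul_one_div_cancel hp0.ne', ENNReal.rpow_one]

lemma mixedLp_minkowski {T : Type} [MeasurableSpace T] (μ : Measure T) [SFinite μ] :
    ∀ (n : ℕ) (p : Fin n → ℝ), (∀ i, 1 < p i) →
    ∀ (F : T → (Fin n → ℝ) → ℝ≥0∞), Measurable (Function.uncurry F) →
    mixedLp n p (fun x => ∫⁻ t, F t x ∂μ) ≤ ∫⁻ t, mixedLp n p (F t) ∂μ
  | 0, p, _, F, hF => by simp only [mixedLp]; rfl
  | n + 1, p, hp, F, hF => by
      simp only [mixedLp]
      have hm : Measurable (fun z : (T × (Fin n → ℝ)) × ℝ => F z.1.1 (Fin.cons z.2 z.1.2)) := by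
        refine hF.comp (measurable_fst.fst.prodMk ?_)
        exact (hs_measurable_cons n).comp (measurable_snd.prodMk measurable_fst.snd)
      refine le_trans ?_ (mixedLp_minkowski μ n _ (fun i => hp i.succ)
        (fun t y => (∫⁻ x : ℝ, (F t (Fin.cons x y)) ^ (p 0)) ^ (1 / p 0)) ?_)
      · refine mixedLp_mono_off n _ (fun i => by linarith [hp i.succ]) _ _ fun y hy => ?_
        refine hs_minkowski μ volume (fun t x => F t (Fin.cons x y)) ?_ (hp 0)
        exact hm.comp (f := fun z : T × ℝ => ((z.1, y), z.2)) (by fun_prop)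
      · refine Measurable.pow_const ?_ _
        exact Measurable.lintegral_prod_right'
          (f := fun z : (T × (Fin n → ℝ)) × ℝ => F z.1.1 (Fin.cons z.2 z.1.2) ^ p 0)
          (hm.pow_const _)

lemma lintegral_comp_mul_left' (g : ℝ → ℝ≥0∞) (t : ℝ) (ht : t ≠ 0) :
    ∫⁻ x : ℝ, g (t * x) = ENNReal.ofReal |t|⁻¹ * ∫⁻ x, g x := by
  have e : MeasurableEmbedding (fun x : ℝ => t * x) :=
    (Homeomorph.mulLeft₀ t ht).measurableEmbedding
  have := e.lintegral_map (μ := volume) g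
  rw [← this, Real.map_volume_mul_left ht, lintegral_smul_measure, abs_inv]
  simp

lemma mixedLp_dilate : ∀ (n : ℕ) (p : Fin n → ℝ), (∀ i, 0 < p i) →
    ∀ (g : (Fin n → ℝ) → ℝ≥0∞) (t : Fin n → ℝ), (∀ i, t i ≠ 0) →
    mixedLp n p (fun x => g (fun i => t i * x i))
      = (∏ i, ENNReal.ofReal (|t i| ^ (-1 / p i))) * mixedLp n p g
  | 0, p, _, g, t, ht => by
      simp only [mixedLp, Finset.univ_eq_empty, Finset.prod_empty, one_mul]
      congr 1
      ext i
      exact i.elim0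
  | n + 1, p, hp, g, t, ht => by
      simp only [mixedLp]
      have hp0 := hp 0
      have ht0 : 0 < |t 0| := abs_pos.2 (ht 0)
      rw [Fin.prod_univ_succ, mul_assoc, ← mixedLp_dilate n (fun i => p i.succ)
        (fun i => hp i.succ) _ (fun i => t i.succ) (fun i => ht i.succ),
        ← mixedLp_const_mul n _ (fun i => hp i.succ) _ _ ENNReal.ofReal_ne_top]
      congr 1
      ext y
      have : ∀ x : ℝ, (fun i => t i * (Fin.cons x y : Fin (n+1) → ℝ) i)
          = (Fin.cons (t 0 * x) (fun i => t i.succ * y i) : Fin (n+1) → ℝ) := by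
        intro x
        ext i
        refine Fin.cases ?_ (fun j => ?_) i <;> simp
      simp_rw [this]
      rw [lintegral_comp_mul_left' (fun x => g (Fin.cons x (fun i => t i.succ * y i)) ^ p 0) _ (ht 0),
        ENNReal.mul_rpow_of_nonneg _ _ (by positivity),
        ENNReal.ofReal_rpow_of_pos (by positivity), ← Real.rpow_neg_one, ← Real.rpow_mul ht0.le]
      congr 3
      ring

lemma hs_int_near (c : ℝ) (hc : -1 < c) :
    Integrable (fun x : ℝ => (Iic (1 / 2 : ℝ)).indicator (fun y => y ^ c) |x|) := by
  have := (integrable_fun_norm_addHaar (E := ℝ) volume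
    (f := (Iic (1 / 2 : ℝ)).indicator (fun y : ℝ => y ^ c))).2 ?_
  · simpa only [Real.norm_eq_abs] using this
  · simp only [Module.finrank_self, Nat.sub_self, pow_zero, one_smul]
    rw [integrableOn_indicator_iff measurableSet_Iic, inter_comm, Ioi_inter_Iic]
    have := intervalIntegral.intervalIntegrable_rpow' (a := 0) (b := 1 / 2) hc
    rwa [intervalIntegrable_iff_integrableOn_Ioc_of_le (by norm_num)] at this

lemma hs_int_far (c : ℝ) (hc : c < -1) :
    Integrable (fun x : ℝ => (Ioi (1 / 2 : ℝ)).indicator (fun y => y ^ c) |x|) := by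
  have := (integrable_fun_norm_addHaar (E := ℝ) volume
    (f := (Ioi (1 / 2 : ℝ)).indicator (fun y : ℝ => y ^ c))).2 ?_
  · simpa only [Real.norm_eq_abs] using this
  · simp only [Module.finrank_self, Nat.sub_self, pow_zero, one_smul]
    rw [integrableOn_indicator_iff measurableSet_Ioi]
    exact (integrableOn_Ioi_rpow_of_lt hc (by norm_num : (0:ℝ) < 1/2)).mono_set inter_subset_left

lemma hs_weight_integrable (a b : ℝ) (ha : 0 < a) (hab : a < b) (hb : b < 1) :
    Integrable (fun t : ℝ => |1 - t| ^ (a - 1) * |t| ^ (-b)) := by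
  have h1 := (hs_int_near (-b) (by linarith)).const_mul ((1 / 2 : ℝ) ^ (a - 1))
  have h2 := ((hs_int_near (a - 1) (by linarith)).comp_sub_left 1).const_mul ((1 / 2 : ℝ) ^ (-b))
  have h3 := (hs_int_far (a - 1 - b) (by linarith)).const_mul ((1 / 3 : ℝ) ^ (a - 1))
  refine ((h1.add h2).add h3).mono' ?_ ?_
  · apply Measurable.aestronglyMeasurable
    fun_prop
  have hi : ∀ (s : Set ℝ) (c y : ℝ), 0 ≤ y → 0 ≤ s.indicator (fun y => y ^ c) y := by
    intro s c y hy
    by_cases h : y ∈ s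
    · rw [indicator_of_mem h]; positivity
    · rw [indicator_of_notMem h]
  refine Filter.Eventually.of_forall fun t => ?_
  have n1 : 0 ≤ (1 / 2 : ℝ) ^ (a - 1) * (Iic (1 / 2 : ℝ)).indicator (fun y => y ^ (-b)) |t| :=
    mul_nonneg (by positivity) (hi _ _ _ (abs_nonneg _))
  have n2 : 0 ≤ (1 / 2 : ℝ) ^ (-b) * (Iic (1 / 2 : ℝ)).indicator (fun y => y ^ (a - 1)) |1 - t| :=
    mul_nonneg (by positivity) (hi _ _ _ (abs_nonneg _))
  have n3 : 0 ≤ (1 / 3 : ℝ) ^ (a - 1) * (Ioi (1 / 2 : ℝ)).indicator (fun y => y ^ (a - 1 - b)) |t| :=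
    mul_nonneg (by positivity) (hi _ _ _ (abs_nonneg _))
  rw [Real.norm_of_nonneg (by positivity)]
  simp only [Pi.add_apply]
  by_cases c1 : |t| ≤ 1 / 2
  · have e : (1 / 2 : ℝ) ≤ |1 - t| := by
      have := abs_le.1 c1
      rw [le_abs]; left; linarith
    have : |1 - t| ^ (a - 1) * |t| ^ (-b)
        ≤ (1 / 2 : ℝ) ^ (a - 1) * (Iic (1 / 2 : ℝ)).indicator (fun y => y ^ (-b)) |t| := by
      rw [indicator_of_mem (show |t| ∈ Iic (1 / 2 : ℝ) from c1)]
      gcongr ?_ * _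
      exact Real.rpow_le_rpow_of_nonpos (by norm_num) e (by linarith)
    linarith
  · push Not at c1
    by_cases c2 : |1 - t| ≤ 1 / 2
    · have : |1 - t| ^ (a - 1) * |t| ^ (-b)
        ≤ (1 / 2 : ℝ) ^ (-b) * (Iic (1 / 2 : ℝ)).indicator (fun y => y ^ (a - 1)) |1 - t| := by
        rw [indicator_of_mem (show |1 - t| ∈ Iic (1 / 2 : ℝ) from c2), mul_comm]
        gcongr ?_ * _
        exact Real.rpow_le_rpow_of_nonpos (by norm_num) c1.le (by linarith)
      linarith
    · push Not at c2
      have e : 1 / 3 * |t| ≤ |1 - t| := by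
        have : |t| ≤ 1 + |1 - t| := by
          calc |t| = |1 - (1 - t)| := by ring_nf
            _ ≤ |1| + |1 - t| := abs_sub _ _
            _ = _ := by simp
        linarith
      have : |1 - t| ^ (a - 1) * |t| ^ (-b)
        ≤ (1 / 3 : ℝ) ^ (a - 1) * (Ioi (1 / 2 : ℝ)).indicator (fun y => y ^ (a - 1 - b)) |t| := by
        rw [indicator_of_mem (show |t| ∈ Ioi (1 / 2 : ℝ) from c1), sub_eq_add_neg (a - 1) b,
          Real.rpow_add (by linarith), ← mul_assoc, ← Real.mul_rpow (by norm_num) (by positivity)]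
        gcongr ?_ * _
        exact Real.rpow_le_rpow_of_nonpos (by linarith) e (by linarith)
      linarith

lemma hs_operator_bound (n : ℕ) (p : Fin n → ℝ) (hp : ∀ i, 1 < p i) (a : ℝ)
    (g : (Fin n → ℝ) → ℝ≥0∞) (hg : Measurable g) :
    mixedLp n p (fun x => ∫⁻ t : Fin n → ℝ, ENNReal.ofReal (∏ i, |1 - t i| ^ (a - 1))
      * g (fun i => t i * x i))
    ≤ (∫⁻ t : Fin n → ℝ, ENNReal.ofReal (∏ i, |1 - t i| ^ (a - 1) * |t i| ^ (-(1 / p i))))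
      * mixedLp n p g := by
  have hp0 : ∀ i, 0 < p i := fun i => by linarith [hp i]
  refine (mixedLp_minkowski volume n p hp _ ?_).trans ?_
  · refine Measurable.mul (by fun_prop) (hg.comp ?_)
    fun_prop
  · rw [← lintegral_mul_const _ (by fun_prop)]
    apply lintegral_mono_ae
    have : ∀ᵐ t : Fin n → ℝ, ∀ i, t i ≠ 0 := by
      rw [ae_all_iff]
      intro i
      have h0 : ∀ᵐ x : ℝ, x ≠ 0 := by simp [ae_iff]
      exact (Measure.quasiMeasurePreserving_eval (fun _ : Fin n => (volume : Measure ℝ)) i).ae h0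
    filter_upwards [this] with t ht
    rw [mixedLp_const_mul n p hp0 _ _ ENNReal.ofReal_ne_top, mixedLp_dilate n p hp0 g t ht,
      ← mul_assoc, ← ENNReal.ofReal_prod_of_nonneg (fun i _ => by positivity),
      ← ENNReal.ofReal_mul (Finset.prod_nonneg fun i _ => by positivity), Finset.prod_mul_distrib]
    simp only [neg_div]
    rfl

lemma hs_change_var (n : ℕ) (a : ℝ) (x : Fin n → ℝ) (hx : ∀ i, x i ≠ 0)
    (g : (Fin n → ℝ) → ℝ≥0∞) (hg : Measurable g) :
    ENNReal.ofReal (∏ i, |x i| ^ (-a)) *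
      ∫⁻ y : Fin n → ℝ, ENNReal.ofReal (∏ i, |x i - y i| ^ (a - 1)) * g y
    = ∫⁻ t : Fin n → ℝ, ENNReal.ofReal (∏ i, |1 - t i| ^ (a - 1)) * g (fun i => t i * x i) := by
  have hdet : (Matrix.diagonal x).det ≠ 0 := by
    rw [Matrix.det_diagonal, Finset.prod_ne_zero_iff]
    exact fun i _ => hx i
  have hv := Real.smul_map_diagonal_volume_pi hdet
  rw [← hv, lintegral_smul_measure, lintegral_map (by fun_prop)
    (LinearMap.continuous_on_pi _).measurable, smul_eq_mul,
    ← mul_assoc, ← lintegral_const_mul' _ _ (by finiteness)]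
  rw [hv]
  apply lintegral_congr
  intro t
  have e : (Matrix.toLin' (Matrix.diagonal x)) t = fun i => t i * x i := by
    ext i
    simp [Matrix.mulVec_diagonal, mul_comm]
  rw [e, ← mul_assoc, Matrix.det_diagonal, Finset.abs_prod,
    ← ENNReal.ofReal_mul (Finset.prod_nonneg fun i _ => by positivity),
    ← ENNReal.ofReal_mul (mul_nonneg (Finset.prod_nonneg fun i _ => by positivity)
      (Finset.prod_nonneg fun i _ => by positivity)),
    ← Finset.prod_mul_distrib, ← Finset.prod_mul_distrib]
  congr 2
  apply Finset.prod_congr rfl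
  intro i _
  have h0 : 0 < |x i| := abs_pos.2 (hx i)
  rw [show x i - t i * x i = x i * (1 - t i) by ring, abs_mul,
    Real.mul_rpow (abs_nonneg _) (abs_nonneg _), ← mul_assoc]
  have : |x i| ^ (-a) * |x i| * |x i| ^ (a - 1) = 1 := by
    nth_rw 2 [← Real.rpow_one |x i|]
    rw [← Real.rpow_add h0, ← Real.rpow_add h0]
    simp
  rw [this, one_mul]

lemma hs_ft_neg (n : ℕ) (h : (Fin n → ℝ) → ℂ) (y : Fin n → ℝ) :
    ft n h (-y) = (((2 * π) ^ (-(n : ℝ) / 2) : ℝ) : ℂ) *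
      ∫ ξ : Fin n → ℝ, Complex.exp (Complex.I * ((∑ i, ξ i * y i : ℝ) : ℂ)) * h ξ := by
  unfold ft
  congr 1
  apply integral_congr_ae
  refine Filter.Eventually.of_forall fun ξ => ?_
  simp only
  congr 2
  push_cast
  rw [← mul_neg, ← Finset.sum_neg_distrib]
  congr 1
  apply Finset.sum_congr rfl
  intro i _
  simp [mul_comm]

open FourierTransform in
lemma hs_ft_eq (n : ℕ) (f : SchwartzMap (Fin n → ℝ) ℂ) :
    ∃ Φ : SchwartzMap (EuclideanSpace ℝ (Fin n)) ℂ,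
      (∀ ξ, ft n f ξ = (((2 * π) ^ (-(n : ℝ) / 2) : ℝ) : ℂ) *
        Φ ((2 * π)⁻¹ • WithLp.toLp 2 ξ)) ∧
      (∀ x, f x = ∫ v : EuclideanSpace ℝ (Fin n),
        Complex.exp (((2 * π * inner ℝ v (WithLp.toLp 2 x) : ℝ) : ℂ) * Complex.I) * Φ v) := by
  let e : EuclideanSpace ℝ (Fin n) ≃L[ℝ] (Fin n → ℝ) := EuclideanSpace.equiv (Fin n) ℝ
  let F := SchwartzMap.compCLMOfContinuousLinearEquiv ℂ e f
  have hF : ∀ v, F v = f (WithLp.ofLp v) := fun v => rfl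
  refine ⟨𝓕 F, fun ξ => ?_, fun x => ?_⟩
  · unfold ft
    congr 1
    rw [SchwartzMap.fourier_coe, Real.fourier_eq',
      ← (PiLp.volume_preserving_toLp (Fin n)).integral_comp
        (MeasurableEquiv.toLp 2 (Fin n → ℝ)).measurableEmbedding]
    apply integral_congr_ae
    refine Filter.Eventually.of_forall fun v => ?_
    simp only [hF, smul_eq_mul]
    congr 2
    rw [inner_smul_right]
    have : -2 * π * ((2 * π)⁻¹ * inner ℝ (WithLp.toLp 2 v) (WithLp.toLp 2 ξ))
        = - ∑ i, ξ i * v i := by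
      have hpi := Real.pi_ne_zero
      field_simp
      simp [PiLp.inner_apply]
    rw [this]
    push_cast
    ring
  · have h1 : 𝓕⁻ (𝓕 F) = F := FourierTransform.fourierInv_fourier_eq F
    have h2 : f x = (𝓕⁻ (𝓕 F)) (WithLp.toLp 2 x) := by rw [h1]; rfl
    rw [h2, SchwartzMap.fourierInv_coe, Real.fourierInv_eq']
    simp only [smul_eq_mul]

lemma hs_ft_schwartz (n : ℕ) (f : SchwartzMap (Fin n → ℝ) ℂ) :
    ∃ Ψ : SchwartzMap (Fin n → ℝ) ℂ, (∀ ξ, ft n f ξ = Ψ ξ) ∧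
      ∀ x, f x = (((2 * π) ^ (-(n : ℝ) / 2) : ℝ) : ℂ) *
        ∫ ξ : Fin n → ℝ, Complex.exp (Complex.I * ((∑ i, ξ i * x i : ℝ) : ℂ)) * Ψ ξ := by
  obtain ⟨Φ, h1, h2⟩ := hs_ft_eq n f
  have hpi : (2 * π)⁻¹ ≠ 0 := by positivity
  let e : (Fin n → ℝ) ≃L[ℝ] EuclideanSpace ℝ (Fin n) :=
    (EuclideanSpace.equiv (Fin n) ℝ).symm.trans
      (ContinuousLinearEquiv.smulLeft (Units.mk0 _ hpi))
  let Ψ := (((2 * π) ^ (-(n : ℝ) / 2) : ℝ) : ℂ) • SchwartzMap.compCLMOfContinuousLinearEquiv ℂ e Φ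
  have hΨ : ∀ ξ, Ψ ξ = (((2 * π) ^ (-(n : ℝ) / 2) : ℝ) : ℂ) * Φ ((2 * π)⁻¹ • WithLp.toLp 2 ξ) :=
    fun ξ => rfl
  refine ⟨Ψ, fun ξ => by rw [h1, hΨ], fun x => ?_⟩
  rw [h2]
  have h3 := Measure.integral_comp_smul (volume : Measure (EuclideanSpace ℝ (Fin n)))
    (fun v => Complex.exp (((2 * π * inner ℝ v (WithLp.toLp 2 x) : ℝ) : ℂ) * Complex.I) * Φ v)
    ((2 * π)⁻¹)
  have h4 : ∫ ξ : Fin n → ℝ, Complex.exp (Complex.I * ((∑ i, ξ i * x i : ℝ) : ℂ)) * Ψ ξ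
      = (((2 * π) ^ (-(n : ℝ) / 2) : ℝ) : ℂ) * ∫ v : EuclideanSpace ℝ (Fin n),
      Complex.exp (((2 * π * inner ℝ ((2 * π)⁻¹ • v) (WithLp.toLp 2 x) : ℝ) : ℂ) * Complex.I)
        * Φ ((2 * π)⁻¹ • v) := by
    rw [← (PiLp.volume_preserving_toLp (Fin n)).integral_comp
        (MeasurableEquiv.toLp 2 (Fin n → ℝ)).measurableEmbedding, ← integral_const_mul]
    apply integral_congr_ae
    refine Filter.Eventually.of_forall fun v => ?_
    simp only [hΨ]
    rw [mul_left_comm]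
    congr 3
    rw [real_inner_smul_left, mul_inv_cancel_left₀ (by positivity), mul_comm]
    congr 2
    simp [PiLp.inner_apply, mul_comm]
  rw [h4, h3]
  simp only [finrank_euclideanSpace, Fintype.card_fin]
  rw [Complex.real_smul, ← mul_assoc, ← mul_assoc]
  have : (((2 * π) ^ (-(n : ℝ) / 2) : ℝ) : ℂ) * (((2 * π) ^ (-(n : ℝ) / 2) : ℝ) : ℂ)
      * ((|((2 * π)⁻¹ ^ n)⁻¹| : ℝ) : ℂ) = 1 := by
    rw [← Complex.ofReal_mul, ← Complex.ofReal_mul, ← Real.rpow_add (by positivity),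
      abs_of_pos (by positivity), inv_pow, inv_inv, ← Real.rpow_natCast,
      ← Real.rpow_add (by positivity)]
    ring_nf
    simp
  rw [this, one_mul]

lemma hs_symbol_integrable (n : ℕ) (s : ℝ) (hs : 0 < s) (Ψ : SchwartzMap (Fin n → ℝ) ℂ) :
    Integrable (fun ξ : Fin n → ℝ => ((((∑ i, ξ i ^ 2) ^ (s / 2) : ℝ)) : ℂ) * Ψ ξ) := by
  have h1 : Integrable (fun ξ : Fin n → ℝ => (n : ℝ) ^ (s / 2) *
      (‖ξ‖ ^ 0 * ‖Ψ ξ‖ + ‖ξ‖ ^ ⌈s⌉₊ * ‖Ψ ξ‖)) :=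
    ((Ψ.integrable_pow_mul volume 0).add (Ψ.integrable_pow_mul volume _)).const_mul _
  refine h1.mono' ?_ ?_
  · apply AEStronglyMeasurable.mul
    · apply Measurable.aestronglyMeasurable
      fun_prop
    · exact Ψ.continuous.aestronglyMeasurable
  · refine Filter.Eventually.of_forall fun ξ => ?_
    have h0 : 0 ≤ ∑ i, ξ i ^ 2 := Finset.sum_nonneg fun i _ => sq_nonneg _
    rw [norm_mul, Complex.norm_real, Real.norm_of_nonneg (by positivity), ← add_mul, ← mul_assoc]
    gcongr
    have h2 : ∑ i, ξ i ^ 2 ≤ n * ‖ξ‖ ^ 2 := by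
      calc ∑ i, ξ i ^ 2 ≤ ∑ i : Fin n, ‖ξ‖ ^ 2 := by
            refine Finset.sum_le_sum fun i _ => ?_
            rw [← sq_abs]
            have := norm_le_pi_norm ξ i
            rw [Real.norm_eq_abs] at this
            gcongr
        _ = _ := by simp
    calc (∑ i, ξ i ^ 2) ^ (s / 2) ≤ (n * ‖ξ‖ ^ 2) ^ (s / 2) := by gcongr
      _ = n ^ (s / 2) * ‖ξ‖ ^ s := by
        rw [Real.mul_rpow (by positivity) (by positivity), ← Real.rpow_natCast ‖ξ‖ 2,
          ← Real.rpow_mul (norm_nonneg _)]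
        congr 2
        push_cast; ring
      _ ≤ _ := by
        gcongr
        rcases le_total ‖ξ‖ 1 with h | h
        · have := Real.rpow_le_one (norm_nonneg ξ) h hs.le
          have : 0 ≤ ‖ξ‖ ^ ⌈s⌉₊ := by positivity
          simp only [pow_zero]; linarith
        · have := Real.rpow_le_rpow_of_exponent_le h (Nat.le_ceil s)
          rw [Real.rpow_natCast] at this
          simp only [pow_zero]; linarith

lemma hs_gauss (n : ℕ) (b : ℝ) (hb : 0 < b) (x ξ : Fin n → ℝ) :
    ∫ y : Fin n → ℝ, ((Real.exp (-(b * ∑ i, (x i - y i) ^ 2)) : ℝ) : ℂ) *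
      Complex.exp (Complex.I * ((∑ i, ξ i * y i : ℝ) : ℂ))
    = (((π / b) ^ ((n : ℝ) / 2) : ℝ) : ℂ) *
      (Complex.exp (Complex.I * ((∑ i, ξ i * x i : ℝ) : ℂ)) *
        ((Real.exp (-((∑ i, ξ i ^ 2) / (4 * b))) : ℝ) : ℂ)) := by
  rw [← integral_sub_left_eq_self _ volume x]
  have h := GaussianFourier.integral_cexp_neg_mul_sum_add (b := (b : ℂ)) (by simpa using hb)
    (fun i : Fin n => -(Complex.I * ξ i))
  calc _ = ∫ v : Fin n → ℝ, Complex.exp (Complex.I * ((∑ i, ξ i * x i : ℝ) : ℂ)) *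
        Complex.exp (-b * ∑ i, (v i : ℂ) ^ 2 + ∑ i, -(Complex.I * ξ i) * v i) := by
        apply integral_congr_ae
        refine Filter.Eventually.of_forall fun v => ?_
        simp only [Pi.sub_apply]
        rw [Complex.ofReal_exp, ← Complex.exp_add, ← Complex.exp_add]
        congr 1
        push_cast
        simp only [mul_sub, Finset.sum_sub_distrib, Finset.mul_sum, neg_mul,
          Finset.sum_neg_distrib, mul_assoc]
        ring
    _ = _ := by
        rw [integral_const_mul, h]
        simp only [Fintype.card_fin]
        rw [mul_left_comm]
        congr 1
        · rw [Complex.ofReal_cpow (by positivity)]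
          push_cast
          rfl
        · congr 1
          rw [Complex.ofReal_exp]
          congr 1
          push_cast
          simp only [neg_sq, mul_pow, Complex.I_sq, neg_one_mul, Finset.sum_neg_distrib, neg_div]

lemma hs_gauss_integrable (n : ℕ) (b : ℝ) (hb : 0 < b) (x : Fin n → ℝ) :
    Integrable (fun y : Fin n → ℝ => ((Real.exp (-(b * ∑ i, (x i - y i) ^ 2)) : ℝ) : ℂ)) := by
  have h := GaussianFourier.integrable_cexp_neg_mul_sum_add (b := (b : ℂ)) (by simpa using hb)
    (fun i : Fin n => 0)
  have := h.comp_sub_left x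
  convert! this using 2 with y
  simp only [Complex.ofReal_exp]
  push_cast
  simp

lemma hs_heat (n : ℕ) (b : ℝ) (hb : 0 < b) (x : Fin n → ℝ) (h : (Fin n → ℝ) → ℂ)
    (hh : Integrable h) :
    ∫ y : Fin n → ℝ, ((Real.exp (-(b * ∑ i, (x i - y i) ^ 2)) : ℝ) : ℂ) * ft n h (-y)
    = (((π / b) ^ ((n : ℝ) / 2) : ℝ) : ℂ) * ((((2 * π) ^ (-(n : ℝ) / 2) : ℝ) : ℂ) *
      ∫ ξ : Fin n → ℝ, Complex.exp (Complex.I * ((∑ i, ξ i * x i : ℝ) : ℂ)) * h ξ *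
        ((Real.exp (-((∑ i, ξ i ^ 2) / (4 * b))) : ℝ) : ℂ)) := by
  have hhI : Integrable (Function.uncurry fun (y ξ : Fin n → ℝ) =>
      ((Real.exp (-(b * ∑ i, (x i - y i) ^ 2)) : ℝ) : ℂ) *
        (Complex.exp (Complex.I * ((∑ i, ξ i * y i : ℝ) : ℂ)) * h ξ))
        (volume.prod volume) := by
    refine ((hs_gauss_integrable n b hb x).mul_prod hh).mono ?_ ?_
    · have m1 : Measurable (fun z : (Fin n → ℝ) × (Fin n → ℝ) =>
        ((Real.exp (-(b * ∑ i, (x i - z.1 i) ^ 2)) : ℝ) : ℂ)) := by fun_prop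
      have m2 : Measurable (fun z : (Fin n → ℝ) × (Fin n → ℝ) =>
        Complex.exp (Complex.I * ((∑ i, z.2 i * z.1 i : ℝ) : ℂ))) := by fun_prop
      exact m1.aestronglyMeasurable.mul (m2.aestronglyMeasurable.mul hh.1.comp_snd)
    · refine Filter.Eventually.of_forall fun z => ?_
      simp only [Function.uncurry, norm_mul]
      rw [mul_comm Complex.I, Complex.norm_exp_ofReal_mul_I, one_mul]
  simp_rw [hs_ft_neg]
  calc _ = (((2 * π) ^ (-(n : ℝ) / 2) : ℝ) : ℂ) * ∫ y : Fin n → ℝ, ∫ ξ : Fin n → ℝ,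
      ((Real.exp (-(b * ∑ i, (x i - y i) ^ 2)) : ℝ) : ℂ) *
        (Complex.exp (Complex.I * ((∑ i, ξ i * y i : ℝ) : ℂ)) * h ξ) := by
        rw [← integral_const_mul]
        apply integral_congr_ae
        refine Filter.Eventually.of_forall fun y => ?_
        simp only
        rw [integral_const_mul]
        ring
    _ = (((2 * π) ^ (-(n : ℝ) / 2) : ℝ) : ℂ) * ∫ ξ : Fin n → ℝ, ∫ y : Fin n → ℝ,
      ((Real.exp (-(b * ∑ i, (x i - y i) ^ 2)) : ℝ) : ℂ) *
        (Complex.exp (Complex.I * ((∑ i, ξ i * y i : ℝ) : ℂ)) * h ξ) := by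
        rw [integral_integral_swap hhI]
    _ = _ := by
        rw [mul_left_comm]
        congr 1
        rw [← integral_const_mul]
        apply integral_congr_ae
        refine Filter.Eventually.of_forall fun ξ => ?_
        simp only [← mul_assoc]
        rw [integral_mul_const, hs_gauss n b hb]
        ring

lemma hs_subord (s r : ℝ) (hs : 0 < s) (hr : 0 < r) :
    IntegrableOn (fun b : ℝ => b ^ (-(s / 2) - 1) * Real.exp (-(r / (4 * b)))) (Ioi 0) ∧
    ∫ b in Ioi (0 : ℝ), b ^ (-(s / 2) - 1) * Real.exp (-(r / (4 * b)))
      = 4 ^ (s / 2) * Real.Gamma (s / 2) * r ^ (-(s / 2)) := by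
  have h1 := Real.integral_rpow_mul_exp_neg_mul_Ioi (a := s / 2) (r := r / 4) (by positivity)
    (by positivity)
  have h2 := integral_comp_rpow_Ioi (fun t : ℝ => t ^ (s / 2 - 1) * Real.exp (-(r / 4 * t)))
    (p := -1) (by norm_num)
  rw [h1] at h2
  have h3 : ∫ b in Ioi (0 : ℝ), b ^ (-(s / 2) - 1) * Real.exp (-(r / (4 * b)))
      = 4 ^ (s / 2) * Real.Gamma (s / 2) * r ^ (-(s / 2)) := by
    have e : (1 / (r / 4)) ^ (s / 2) * Real.Gamma (s / 2) =
        4 ^ (s / 2) * Real.Gamma (s / 2) * r ^ (-(s / 2)) := by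
      rw [one_div_div, Real.div_rpow (by norm_num) hr.le, Real.rpow_neg hr.le]
      ring
    rw [← e, ← h2]
    apply setIntegral_congr_fun measurableSet_Ioi
    intro b hb
    have hb : 0 < b := hb
    simp only [smul_eq_mul, abs_neg, abs_one, one_mul]
    rw [← Real.rpow_mul hb.le, ← mul_assoc, ← Real.rpow_add hb, Real.rpow_neg_one]
    congr 2
    · congr 1; ring
    · field_simp
  refine ⟨?_, h3⟩
  apply Integrable.of_integral_ne_zero
  rw [h3]
  have := Real.Gamma_pos_of_pos (show 0 < s / 2 by positivity)
  positivity

lemma hs_gamma_lint (c r : ℝ) (hc : 0 < c) (hr : 0 < r) :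
    ∫⁻ b in Ioi (0 : ℝ), ENNReal.ofReal (b ^ (c - 1) * Real.exp (-(b * r)))
      = ENNReal.ofReal (Real.Gamma c * r ^ (-c)) := by
  have h1 := Real.integral_rpow_mul_exp_neg_mul_Ioi hc hr
  have hG := Real.Gamma_pos_of_pos hc
  have e : (1 / r) ^ c * Real.Gamma c = Real.Gamma c * r ^ (-c) := by
    rw [one_div, Real.inv_rpow hr.le, Real.rpow_neg hr.le]
    ring
  rw [e] at h1
  simp_rw [mul_comm r] at h1
  rw [← h1, ofReal_integral_eq_lintegral_ofReal]
  · apply Integrable.of_integral_ne_zero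
    rw [h1]
    positivity
  · rw [Filter.EventuallyLE, ae_restrict_iff' measurableSet_Ioi]
    refine Filter.Eventually.of_forall fun b hb => ?_
    have hb : 0 < b := hb
    simp only [Pi.zero_apply]
    positivity

lemma hs_ae_ne (n : ℕ) (x : Fin n → ℝ) : ∀ᵐ y : Fin n → ℝ, ∀ i, y i ≠ x i := by
  rw [ae_all_iff]
  intro i
  have h0 : ∀ᵐ z : ℝ, z ≠ x i := by simp [ae_iff]
  exact (Measure.quasiMeasurePreserving_eval (fun _ : Fin n => (volume : Measure ℝ)) i).ae h0

lemma hs_sumsq_pos {n : ℕ} (hn : 1 ≤ n) (x : Fin n → ℝ) (hx : ∀ i, x i ≠ 0) :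
    0 < ∑ i, x i ^ 2 :=
  Finset.sum_pos (fun i _ => by have := hx i; positivity) ⟨⟨0, hn⟩, Finset.mem_univ _⟩

lemma hs_sumsq_rpow_le {n : ℕ} (x : Fin n → ℝ) (hx : ∀ i, x i ≠ 0)
    (c : ℝ) (hc : c ≤ 0) : (∑ i, x i ^ 2) ^ (n * c / 2) ≤ ∏ i, |x i| ^ c := by
  have h0 : 0 ≤ ∑ i, x i ^ 2 := Finset.sum_nonneg fun i _ => sq_nonneg _
  calc (∑ i, x i ^ 2) ^ (n * c / 2) = ∏ _i : Fin n, (∑ j, x j ^ 2) ^ (c / 2) := by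
        rw [Finset.prod_const, Finset.card_univ, Fintype.card_fin, ← Real.rpow_natCast,
          ← Real.rpow_mul h0]
        congr 1; ring
    _ ≤ ∏ i, |x i| ^ c := by
        apply Finset.prod_le_prod
        · intro i _; positivity
        · intro i _
          have hxi : 0 < |x i| := abs_pos.2 (hx i)
          calc (∑ j, x j ^ 2) ^ (c / 2) ≤ (x i ^ 2) ^ (c / 2) := by
                apply Real.rpow_le_rpow_of_nonpos (by have := hx i; positivity)
                · exact Finset.single_le_sum (f := fun j => x j ^ 2) (fun j _ => sq_nonneg _)
                    (Finset.mem_univ i)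
                · linarith
            _ = |x i| ^ c := by
                rw [← sq_abs, ← Real.rpow_natCast, ← Real.rpow_mul hxi.le]
                congr 1; push_cast; ring

lemma hs_ft_measurable (n : ℕ) (h : (Fin n → ℝ) → ℂ) (hh : Measurable h) :
    Measurable (fun y => ft n h (-y)) := by
  simp_rw [hs_ft_neg]
  refine Measurable.const_mul ?_ _
  apply StronglyMeasurable.measurable
  refine StronglyMeasurable.integral_prod_right' (f := fun z : (Fin n → ℝ) × (Fin n → ℝ) =>
    Complex.exp (Complex.I * ((∑ i, z.2 i * z.1 i : ℝ) : ℂ)) * h z.2) ?_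
  apply Measurable.stronglyMeasurable
  refine Measurable.mul (by fun_prop) (hh.comp measurable_snd)

lemma hs_fracLap_measurable (n : ℕ) (s : ℝ) (f : SchwartzMap (Fin n → ℝ) ℂ) :
    Measurable (fracLap n s f) := by
  obtain ⟨Ψ, h1, -⟩ := hs_ft_schwartz n f
  unfold fracLap fracLapOn
  simp_rw [h1]
  apply hs_ft_measurable
  have := Ψ.continuous.measurable
  fun_prop

/-- Subordination formula for `f` in terms of heat averages of `Λ^s f`. -/
lemma hs_subord_formula (n : ℕ) (hn : 1 ≤ n) (s : ℝ) (hs : 0 < s)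
    (f : SchwartzMap (Fin n → ℝ) ℂ) (x : Fin n → ℝ) :
    ((4 ^ (s / 2) * Real.Gamma (s / 2) : ℝ) : ℂ) * f x =
      ∫ b in Ioi (0 : ℝ), ((b ^ (-(s / 2) - 1) * (π / b) ^ (-((n : ℝ) / 2)) : ℝ) : ℂ) *
        ∫ y : Fin n → ℝ, ((Real.exp (-(b * ∑ i, (x i - y i) ^ 2)) : ℝ) : ℂ) *
          fracLap n s f y := by
  obtain ⟨Ψ, h1, h2⟩ := hs_ft_schwartz n f
  set h : (Fin n → ℝ) → ℂ := fun ξ => ((((∑ i, ξ i ^ 2) ^ (s / 2) : ℝ)) : ℂ) * Ψ ξ with hh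
  have hhI : Integrable h := hs_symbol_integrable n s hs Ψ
  have hmeas : Measurable h := by
    have := Ψ.continuous.measurable
    fun_prop
  have hfl : ∀ y, fracLap n s f y = ft n h (-y) := by
    intro y
    unfold fracLap fracLapOn
    simp_rw [h1]
    rfl
  set A : ℝ := 4 ^ (s / 2) * Real.Gamma (s / 2) with hA
  have hApos : 0 < A := by
    have := Real.Gamma_pos_of_pos (show 0 < s / 2 by positivity)
    positivity
  set E : (Fin n → ℝ) → ℂ := fun ξ => Complex.exp (Complex.I * ((∑ i, ξ i * x i : ℝ) : ℂ)) with hE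
  have hEn : ∀ ξ, ‖E ξ‖ = 1 := by
    intro ξ
    simp only [hE]
    rw [mul_comm Complex.I, Complex.norm_exp_ofReal_mul_I]
  set k : (Fin n → ℝ) → ℝ → ℝ := fun ξ b =>
    b ^ (-(s / 2) - 1) * Real.exp (-((∑ i, ξ i ^ 2) / (4 * b))) with hk
  have hpos : ∀ᵐ ξ : Fin n → ℝ, 0 < ∑ i, ξ i ^ 2 := by
    filter_upwards [hs_ae_ne n 0] with ξ hξ
    exact hs_sumsq_pos hn ξ hξ
  have hcancel : ∀ ξ : Fin n → ℝ, 0 < ∑ i, ξ i ^ 2 →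
      (∑ i, ξ i ^ 2) ^ (s / 2) * (∑ i, ξ i ^ 2) ^ (-(s / 2)) = 1 := by
    intro ξ hξ
    rw [← Real.rpow_add hξ]; simp
  have hF : Integrable (Function.uncurry fun (ξ : Fin n → ℝ) (b : ℝ) => E ξ * h ξ * ((k ξ b : ℝ) : ℂ))
      (volume.prod (volume.restrict (Ioi 0))) := by
    rw [integrable_prod_iff]
    · constructor
      · filter_upwards [hpos] with ξ hξ
        exact ((hs_subord s _ hs hξ).1.ofReal (𝕜 := ℂ)).const_mul (E ξ * h ξ)
      · have : Integrable (fun ξ => A * ‖Ψ ξ‖) := Ψ.integrable.norm.const_mul A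
        refine this.congr ?_
        filter_upwards [hpos] with ξ hξ
        simp only [Function.uncurry, norm_mul, hEn, one_mul, Complex.norm_real]
        rw [integral_const_mul]
        have e : ∫ b in Ioi (0 : ℝ), ‖k ξ b‖ = A * (∑ i, ξ i ^ 2) ^ (-(s / 2)) := by
          rw [hA, ← (hs_subord s _ hs hξ).2]
          apply setIntegral_congr_fun measurableSet_Ioi
          intro b hb
          have hb : 0 < b := hb
          simp only [hk]
          rw [Real.norm_of_nonneg (by positivity)]
        rw [e]
        simp only [hh, norm_mul, Complex.norm_real]
        rw [Real.norm_of_nonneg (by positivity)]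
        linear_combination (-A * ‖Ψ ξ‖) * hcancel ξ hξ
    · apply Measurable.aestronglyMeasurable
      have m1 : Measurable (fun z : (Fin n → ℝ) × ℝ => E z.1) := by fun_prop
      have m2 : Measurable (fun z : (Fin n → ℝ) × ℝ => k z.1 z.2) := by fun_prop
      exact (m1.mul (hmeas.comp measurable_fst)).mul (Complex.measurable_ofReal.comp m2)
  set c0 : ℂ := (((2 * π) ^ (-(n : ℝ) / 2) : ℝ) : ℂ) with hc0
  calc (A : ℂ) * f x = c0 * ∫ ξ : Fin n → ℝ, ∫ b in Ioi (0 : ℝ), E ξ * h ξ * ((k ξ b : ℝ) : ℂ) := by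
        rw [h2 x, mul_left_comm]
        congr 1
        rw [← integral_const_mul]
        apply integral_congr_ae
        filter_upwards [hpos] with ξ hξ
        rw [integral_const_mul, integral_complex_ofReal, (hs_subord s _ hs hξ).2]
        simp only [hh]
        have := congrArg (fun r : ℝ => (r : ℂ)) (hcancel ξ hξ)
        simp only [Complex.ofReal_mul, Complex.ofReal_one] at this
        rw [← hA]
        change (A : ℂ) * (E ξ * Ψ ξ) = E ξ * _ * _
        rw [Complex.ofReal_mul A]
        linear_combination (-(A : ℂ) * E ξ * Ψ ξ) * this
    _ = c0 * ∫ b in Ioi (0 : ℝ), ∫ ξ : Fin n → ℝ, E ξ * h ξ * ((k ξ b : ℝ) : ℂ) := by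
        rw [integral_integral_swap hF]
    _ = _ := by
        rw [← integral_const_mul]
        apply setIntegral_congr_fun measurableSet_Ioi
        intro b hb
        have hb : 0 < b := hb
        simp only [hfl]
        rw [hs_heat n b hb x h hhI, ← mul_assoc, ← Complex.ofReal_mul, mul_assoc (b ^ _),
          ← Real.rpow_add (by positivity), neg_add_cancel, Real.rpow_zero, mul_one, mul_left_comm]
        rw [← hc0]
        congr 1
        rw [← integral_const_mul]
        apply integral_congr_ae
        refine Filter.Eventually.of_forall fun ξ => ?_
        simp only [hk, hE]
        push_cast
        ring

lemma hs_riesz (n : ℕ) (hn : 1 ≤ n) (s : ℝ) (hs : 0 < s) (hsn : s < n) :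
    ∃ C : ℝ≥0∞, C ≠ ∞ ∧ ∀ (f : SchwartzMap (Fin n → ℝ) ℂ) (x : Fin n → ℝ),
      ‖f x‖ₑ ≤ C * ∫⁻ y : Fin n → ℝ, ENNReal.ofReal (∏ i, |x i - y i| ^ (s / n - 1)) *
        ‖fracLap n s f y‖ₑ := by
  have hn0 : (0 : ℝ) < n := by exact_mod_cast hn
  set A : ℝ := 4 ^ (s / 2) * Real.Gamma (s / 2) with hA
  have hApos : 0 < A := by
    have := Real.Gamma_pos_of_pos (show 0 < s / 2 by positivity)
    positivity
  set c : ℝ := ((n : ℝ) - s) / 2 with hc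
  have hcpos : 0 < c := by rw [hc]; linarith
  have hG := Real.Gamma_pos_of_pos hcpos
  set B : ℝ := π ^ (-((n : ℝ) / 2)) with hB
  have hBpos : 0 < B := by positivity
  refine ⟨ENNReal.ofReal (A⁻¹ * (B * Real.Gamma c)), ENNReal.ofReal_ne_top, fun f x => ?_⟩
  have hgm := (hs_fracLap_measurable n s f).enorm
  have key : ENNReal.ofReal A * ‖f x‖ₑ ≤ ENNReal.ofReal (B * Real.Gamma c) *
      ∫⁻ y : Fin n → ℝ, ENNReal.ofReal (∏ i, |x i - y i| ^ (s / n - 1)) * ‖fracLap n s f y‖ₑ := by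
    have e1 : ENNReal.ofReal A * ‖f x‖ₑ = ‖((A : ℝ) : ℂ) * f x‖ₑ := by
      rw [enorm_mul, ← ofReal_norm_eq_enorm ((A : ℝ) : ℂ), Complex.norm_real,
        Real.norm_of_nonneg hApos.le]
    rw [e1, hs_subord_formula n hn s hs f x]
    calc _ ≤ ∫⁻ b in Ioi (0 : ℝ), ∫⁻ y : Fin n → ℝ,
          ENNReal.ofReal B * (ENNReal.ofReal (b ^ (c - 1) *
            Real.exp (-(b * ∑ i, (x i - y i) ^ 2))) * ‖fracLap n s f y‖ₑ) := by
          refine (enorm_integral_le_lintegral_enorm _).trans ?_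
          apply setLIntegral_mono' measurableSet_Ioi
          intro b hb
          have hb : 0 < b := hb
          rw [enorm_mul]
          refine (mul_le_mul_right (enorm_integral_le_lintegral_enorm _) _).trans ?_
          rw [← lintegral_const_mul' _ _ enorm_ne_top]
          apply lintegral_mono
          intro y
          simp only
          rw [enorm_mul, ← ofReal_norm_eq_enorm, ← ofReal_norm_eq_enorm, Complex.norm_real,
            Complex.norm_real, Real.norm_of_nonneg (by positivity),
            Real.norm_of_nonneg (by positivity), ← mul_assoc, ← mul_assoc,
            ← ENNReal.ofReal_mul (by positivity), ← ENNReal.ofReal_mul (by positivity)]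
          apply le_of_eq
          congr 2
          rw [← mul_assoc]
          congr 1
          rw [Real.div_rpow pi_pos.le hb.le, Real.rpow_neg hb.le ((n : ℝ) / 2), div_inv_eq_mul,
            mul_left_comm, ← Real.rpow_add hb]
          congr 2
          rw [hc]; ring
      _ = ∫⁻ y : Fin n → ℝ, ∫⁻ b in Ioi (0 : ℝ),
          ENNReal.ofReal B * (ENNReal.ofReal (b ^ (c - 1) *
            Real.exp (-(b * ∑ i, (x i - y i) ^ 2))) * ‖fracLap n s f y‖ₑ) := by
          rw [lintegral_lintegral_swap]
          apply Measurable.aemeasurable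
          refine Measurable.const_mul (Measurable.mul (by fun_prop) (hgm.comp measurable_snd)) _
      _ ≤ ∫⁻ y : Fin n → ℝ, ENNReal.ofReal (B * Real.Gamma c) *
          (ENNReal.ofReal (∏ i, |x i - y i| ^ (s / n - 1)) * ‖fracLap n s f y‖ₑ) := by
          apply lintegral_mono_ae
          filter_upwards [hs_ae_ne n x] with y hy
          have hy' : ∀ i, (x - y) i ≠ 0 := fun i => sub_ne_zero.2 (hy i).symm
          have hpos : 0 < ∑ i, (x i - y i) ^ 2 := hs_sumsq_pos hn (x - y) hy'
          rw [lintegral_const_mul' _ _ ENNReal.ofReal_ne_top,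
            lintegral_mul_const' _ _ enorm_ne_top, hs_gamma_lint c _ hcpos hpos,
            ← mul_assoc, ← mul_assoc, ← ENNReal.ofReal_mul (by positivity),
            ← ENNReal.ofReal_mul (by positivity), ← mul_assoc]
          gcongr
          have := hs_sumsq_rpow_le (x - y) hy' (s / n - 1) (by
            rw [sub_nonpos, div_le_one hn0]; exact hsn.le)
          refine le_trans (le_of_eq ?_) this
          simp only [Pi.sub_apply]
          congr 1
          rw [hc]
          field_simp
          ring
      _ = _ := by
          rw [lintegral_const_mul' _ _ ENNReal.ofReal_ne_top]
  calc ‖f x‖ₑ = ENNReal.ofReal A⁻¹ * (ENNReal.ofReal A * ‖f x‖ₑ) := by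
        rw [← mul_assoc, ← ENNReal.ofReal_mul (by positivity), inv_mul_cancel₀ hApos.ne']
        simp
    _ ≤ ENNReal.ofReal A⁻¹ * (ENNReal.ofReal (B * Real.Gamma c) *
      ∫⁻ y : Fin n → ℝ, ENNReal.ofReal (∏ i, |x i - y i| ^ (s / n - 1)) *
        ‖fracLap n s f y‖ₑ) := mul_le_mul_right key _
    _ = _ := by
        rw [← mul_assoc, ← ENNReal.ofReal_mul (by positivity)]
/-- **Anisotropic Hardy–Sobolev inequality in mixed Lebesgue spaces.**
If `1 < pᵢ < ∞` and `0 < s < n/pᵢ` for all `i`, then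
`‖ f(x)/|x|^s ‖_{L^{p⃗}(ℝⁿ)} ≤ C ‖ Λ^s f ‖_{L^{p⃗}(ℝⁿ)}` for all Schwartz `f`. -/
theorem anisotropic_hardy_sobolev_mixed_lebesgue
    (n : ℕ) (hn : 1 ≤ n) (p : Fin n → ℝ)
    (hp : ∀ i, 1 < p i)
    (s : ℝ) (hs : 0 < s) (hsn : ∀ i, s < n / p i) :
    ∃ C : ℝ, 0 < C ∧ ∀ f : SchwartzMap ((Fin n) → ℝ) ℂ,
      mixedLp n p
        (fun x => (‖f x / ((((∑ i, x i ^ 2) ^ (s / 2) : ℝ)) : ℂ)‖₊ : ℝ≥0∞))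
      ≤ ENNReal.ofReal C *
        mixedLp n p (fun x => (‖fracLap n s (⇑f) x‖₊ : ℝ≥0∞)) := by
  have hn0 : (0 : ℝ) < n := by exact_mod_cast hn
  have hp0 : ∀ i, 0 < p i := fun i => by linarith [hp i]
  have hsn' : s < n := by
    have h := hsn ⟨0, hn⟩
    have h1 := hp ⟨0, hn⟩
    exact h.trans (div_lt_self hn0 h1)
  set a : ℝ := s / n with ha
  have ha0 : 0 < a := by positivity
  obtain ⟨C, hC, hriesz⟩ := hs_riesz n hn s hs hsn'
  set K : ℝ≥0∞ := ∫⁻ t : Fin n → ℝ,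
    ENNReal.ofReal (∏ i, |1 - t i| ^ (a - 1) * |t i| ^ (-(1 / p i))) with hK
  have hKfin : K ≠ ∞ := by
    have hI : Integrable (fun t : Fin n → ℝ =>
        ∏ i, |1 - t i| ^ (a - 1) * |t i| ^ (-(1 / p i))) := by
      refine Integrable.fintype_prod (f := fun i (t : ℝ) =>
        |1 - t| ^ (a - 1) * |t| ^ (-(1 / p i))) fun i => ?_
      refine hs_weight_integrable a (1 / p i) ha0 ?_ ?_
      · have := hsn i
        have := hp0 i
        rw [lt_div_iff₀ (hp0 i)] at *
        rw [ha, div_mul_eq_mul_div, div_lt_one hn0]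
        assumption
      · rw [div_lt_one (hp0 i)]
        exact hp i
    exact hI.lintegral_lt_top.ne
  refine ⟨(C * K).toReal + 1, by positivity, fun f => ?_⟩
  have hgm := (hs_fracLap_measurable n s f).enorm
  calc mixedLp n p
        (fun x => (‖f x / ((((∑ i, x i ^ 2) ^ (s / 2) : ℝ)) : ℂ)‖₊ : ℝ≥0∞))
      ≤ mixedLp n p (fun x => C * ∫⁻ t : Fin n → ℝ,
          ENNReal.ofReal (∏ i, |1 - t i| ^ (a - 1)) *
            (fun y => ‖fracLap n s f y‖ₑ) (fun i => t i * x i)) := by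
        refine mixedLp_mono_off n p hp0 _ _ fun x hx => ?_
        rw [← hs_change_var n a x hx _ hgm]
        have hpos := hs_sumsq_pos hn x hx
        have e : ((‖f x / ((((∑ i, x i ^ 2) ^ (s / 2) : ℝ)) : ℂ)‖₊ : ℝ≥0∞))
            = ENNReal.ofReal ((∑ i, x i ^ 2) ^ (n * (-a) / 2)) * ‖f x‖ₑ := by
          rw [← enorm_eq_nnnorm, ← ofReal_norm_eq_enorm, ← ofReal_norm_eq_enorm,
            ← ENNReal.ofReal_mul (by positivity), norm_div, Complex.norm_real,
            Real.norm_of_nonneg (by positivity), div_eq_inv_mul, ← Real.rpow_neg hpos.le]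
          congr 3
          rw [ha]
          field_simp
        rw [e, mul_left_comm]
        gcongr
        · exact hs_sumsq_rpow_le x hx (-a) (by linarith)
        · exact hriesz f x
    _ = C * mixedLp n p (fun x => ∫⁻ t : Fin n → ℝ,
          ENNReal.ofReal (∏ i, |1 - t i| ^ (a - 1)) *
            (fun y => ‖fracLap n s f y‖ₑ) (fun i => t i * x i)) :=
        mixedLp_const_mul n p hp0 _ C hC
    _ ≤ C * (K * mixedLp n p (fun y => ‖fracLap n s f y‖ₑ)) := by
        gcongr
        exact hs_operator_bound n p hp a _ hgm
    _ ≤ ENNReal.ofReal ((C * K).toReal + 1) *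
        mixedLp n p (fun x => (‖fracLap n s (⇑f) x‖₊ : ℝ≥0∞)) := by
        rw [← mul_assoc]
        refine mul_le_mul' ?_ (le_of_eq rfl)
        rw [← ENNReal.ofReal_toReal (ENNReal.mul_ne_top hC hKfin)]
        apply ENNReal.ofReal_le_ofReal
        rw [ENNReal.ofReal_toReal (ENNReal.mul_ne_top hC hKfin)]
        linarith
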